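/- arXiv:2202.06001 — 3 statements merged into one kernel-verified Lean document; each statement's English description precedes it below -/
import Mathlib

section
/- Let R be a commutative ring, n a finite type with decidable equality, and M : Matrix n n R a column constant matrix. Then det(1 + M) = 1 + trace M. -/
/-- If `M` is a column constant square matrix, then `det(1 + M) = 1 + trace M`. -/
theorem det_one_add_column_constant {R n : Type*} [CommRing R] [Fintype n] [DecidableEq n]
    (M : Matrix n n R) (h : ∀ r s j, M r j = M s j) :
    (1 + M).det = 1 + M.trace := by
  have hM : M = Matrix.replicateCol Unit (fun _ => (1 : R)) *
      Matrix.replicateRow Unit (fun j => M j j) := by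
    ext i j
    simp [Matrix.mul_apply, h i j j]
  have key := Matrix.det_one_add_replicateCol_mul_replicateRow (ι := Unit)
    (fun _ : n => (1 : R)) (fun j => M j j)
  rw [← hM] at key
  rw [key]
  simp [dotProduct, Matrix.trace]
end

section
/- Let R be a commutative ring, k and l finite types with decidable equality, and let B : Matrix k l R and C : Matrix l k R both be column constant. Then det(fromBlocks 1 B C 1) = det(1 − B·C) = det(1 − C·B) = 1 − ρ_B·ρ_C, where ρ_B = ∑_j B i j for any i : k and ρ_C = ∑_j C i' j for any i' : l are the row sums; explicitly, for all i : k and i' : l, det(fromBlocks 1 B C 1) = 1 − (∑_j B i j)·(∑_j C i' j). -/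
/-- If `B : Matrix k l R` and `C : Matrix l k R` are column constant, then
`det(fromBlocks 1 B C 1) = det(1 − B·C) = det(1 − C·B) = 1 − ρ_B·ρ_C`,
where `ρ_B = ∑_j B i j` and `ρ_C = ∑_j C i' j` are the row sums (independent of the
chosen rows `i : k`, `i' : l`). -/
theorem det_fromBlocks_one_column_constant
    {R k l : Type*} [CommRing R] [Fintype k] [Fintype l] [DecidableEq k] [DecidableEq l]
    (B : Matrix k l R) (C : Matrix l k R)
    (hB : ∀ r s j, B r j = B s j) (hC : ∀ r s j, C r j = C s j) :
    (Matrix.fromBlocks (1 : Matrix k k R) B C 1).det = (1 - B * C).det ∧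
    (1 - B * C).det = (1 - C * B).det ∧
    ∀ (i : k) (i' : l),
      (Matrix.fromBlocks (1 : Matrix k k R) B C 1).det
        = 1 - (∑ j, B i j) * (∑ j, C i' j) := by
  refine ⟨Matrix.det_fromBlocks_one₂₂ _ _ _, Matrix.det_one_sub_mul_comm _ _, fun i i' => ?_⟩
  have h : (1 : Matrix k k R) - B * C = 1 + Matrix.replicateCol Unit (fun _ => -∑ j, B i j) *
      Matrix.replicateRow Unit (C i') := by
    rw [sub_eq_add_neg]
    congr 1
    ext r s
    rw [Matrix.neg_apply, Matrix.mul_apply, Matrix.mul_apply]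
    simp only [Matrix.replicateCol_apply, Matrix.replicateRow_apply, Finset.univ_unique,
      Finset.sum_singleton, neg_mul, Finset.sum_mul]
    congr 1
    exact Finset.sum_congr rfl fun j _ => by rw [hB r i j, hC j i' s]
  rw [Matrix.det_fromBlocks_one₂₂, h, Matrix.det_one_add_replicateCol_mul_replicateRow]
  simp only [dotProduct, mul_neg, Finset.sum_neg_distrib, ← Finset.sum_mul]
  ring
end

section
/- Let V and A be types with maps 𝔱, 𝔥 : A → V, let R be a commutative ring, let τ : A → R, and let q ∈ R. Define the Mizuno–Sato weight map of Bartholdi type θ(a,a') = τ(a')·([𝔥(a) = 𝔱(a')] − (1 − q)·[a' ∈ S(a)]). Let m ≥ 1 and let c : ZMod m → A be a closed path, i.e., 𝔥(c i) = 𝔱(c (i+1)) for all i ∈ ZMod m. Then the circular product of θ along c equals the product of the τ-weights times q to the cyclic bump count: ∏_{i ∈ ZMod m} θ(c i, c (i+1)) = (∏_{i ∈ ZMod m} τ(c i)) · q^{|{ i ∈ ZMod m : c (i+1) ∈ S(c i) }|}. -/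
/-- For the Mizuno–Sato weight map of Bartholdi type
`θ(a,a') = τ(a')·([𝔥(a) = 𝔱(a')] − (1 − q)·[a' ∈ S(a)])`, the circular product of `θ`
along a closed path `c : ZMod m → A` (satisfying `𝔥(c i) = 𝔱(c (i+1))` for all `i`)
equals the product of the `τ`-weights times `q` raised to the cyclic bump count:
`∏_i θ(c i, c (i+1)) = (∏_i τ(c i)) · q^{#{i : c (i+1) ∈ S(c i)}}`.
Here `a' ∈ S(a)` means `𝔱(a') = 𝔥(a) ∧ 𝔥(a') = 𝔱(a)`. -/
theorem circular_product_mizuno_sato_bartholdi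
    {V A R : Type*} [DecidableEq V] [CommRing R]
    (𝔱 𝔥 : A → V) (τ : A → R) (q : R) (m : ℕ) [NeZero m] (hm : 1 ≤ m)
    (c : ZMod m → A) (hc : ∀ i : ZMod m, 𝔥 (c i) = 𝔱 (c (i + 1))) :
    ∏ i : ZMod m,
        (τ (c (i + 1)) * ((if 𝔥 (c i) = 𝔱 (c (i + 1)) then 1 else 0)
          - (1 - q) * (if 𝔱 (c (i + 1)) = 𝔥 (c i) ∧ 𝔥 (c (i + 1)) = 𝔱 (c i) then 1 else 0)))
      = (∏ i : ZMod m, τ (c i)) *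
        q ^ (Finset.univ.filter
              (fun i : ZMod m => 𝔱 (c (i + 1)) = 𝔥 (c i) ∧ 𝔥 (c (i + 1)) = 𝔱 (c i))).card := by
  rw [Finset.prod_mul_distrib]
  congr 1
  · exact Equiv.prod_comp (Equiv.addRight (1 : ZMod m)) (fun i => τ (c i))
  · rw [← Finset.prod_const, Finset.prod_filter]
    refine Finset.prod_congr rfl fun i _ => ?_
    rw [if_pos (hc i)]
    split_ifs <;> ring
end
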